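/- Let H ∈ (0,1/2), α = H + 1/2, T ∈ (0,∞), W a Brownian motion, and for x > 0 set Y_t(x) = (1/Γ(1/2 - H)) ∫₀^t e^{-(t-s)x} dW_s. Then for each fixed t ∈ [0,T], almost surely ∫₀^∞ Y_t(x) x^{-α} dx = ∫₀^t (t-s)^{H-1/2} dW_s, where the left side is almost surely absolutely convergent. -/

import Mathlib

open MeasureTheory ProbabilityTheory



lemma aux_gamma {a r : ℝ} (ha : 0 < a) (hr : 0 < r) :
    IntegrableOn (fun x : ℝ => x ^ (a - 1) * Real.exp (-(r * x))) (Set.Ioi 0) := by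
  by_contra h
  have h1 := Real.integral_rpow_mul_exp_neg_mul_Ioi ha hr
  rw [integral_undef h] at h1
  have h2 := Real.Gamma_pos_of_pos ha
  have h3 : 0 < (1 / r) ^ a := by positivity
  have := mul_pos h3 h2
  linarith

/-- limit of the boundary term vanishes -/
lemma aux_boundary {p t c : ℝ} (ht : 0 < t) {v : ℝ → ℝ}
    (hint : IntegrableOn (fun r => v r * r ^ (p - 1)) (Set.Ioc 0 t))
    (hlim : Filter.Tendsto (fun r => r ^ p * v r) (nhdsWithin 0 (Set.Ioi 0)) (nhds c)) :
    c = 0 := by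
  by_contra hc
  have h1 : ∀ᶠ r in nhdsWithin 0 (Set.Ioi 0), |c| / 2 < |r ^ p * v r| := by
    apply hlim.abs.eventually (lt_mem_nhds _)
    have := abs_pos.2 hc
    linarith
  rw [eventually_nhdsWithin_iff, Metric.eventually_nhds_iff] at h1
  obtain ⟨δ, hδ, h1⟩ := h1
  set d := min (δ / 2) t with hd
  have hd0 : 0 < d := by positivity
  have hi : IntegrableOn (fun r => v r * r ^ (p - 1)) (Set.Ioc 0 d) :=
    hint.mono_set (Set.Ioc_subset_Ioc_right (min_le_right _ _))
  have h2 : IntegrableOn (fun r : ℝ => r⁻¹) (Set.Ioc 0 d) := by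
    refine Integrable.mono (hi.const_mul (2 / |c|)) (by fun_prop) ?_
    filter_upwards [ae_restrict_mem measurableSet_Ioc] with r hr
    have hcp := abs_pos.2 hc
    have hr0 : 0 < r := hr.1
    have h3 := h1 (y := r) (by
      rw [Real.dist_eq, sub_zero, abs_of_pos hr0]
      have := hr.2
      have : d ≤ δ / 2 := min_le_left _ _
      linarith) hr0
    rw [Real.rpow_sub_one hr0.ne']
    have h4 : 2 / |c| * (v r * (r ^ p / r)) = (2 / |c|) * ((r ^ p * v r) * r⁻¹) := by
      field_simp
    rw [h4, norm_mul, norm_mul, Real.norm_eq_abs, Real.norm_eq_abs, Real.norm_eq_abs, ← mul_assoc]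
    have h5 : 1 ≤ |(2 / |c|)| * |r ^ p * v r| := by
      rw [abs_of_pos (by positivity)]
      rw [div_mul_eq_mul_div, le_div_iff₀ hcp]
      linarith
    exact le_mul_of_one_le_left (abs_nonneg _) h5
  have h3 : IntervalIntegrable (fun r : ℝ => r⁻¹) volume 0 d :=
    (intervalIntegrable_iff_integrableOn_Ioc_of_le hd0.le).2 h2
  rw [intervalIntegrable_inv_iff] at h3
  rcases h3 with h3 | h3
  · linarith
  · exact h3 Set.left_mem_uIcc

lemma aux_Z {H t z : ℝ} (hH : H ∈ Set.Ioo (0 : ℝ) (1/2)) (ht : 0 < t)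
    {w : ℝ → ℝ} (hw : Continuous w)
    (hint : IntegrableOn (fun r => (w t - w (t - r)) * r ^ (H - 3/2)) (Set.Ioc 0 t))
    (hZ : Filter.Tendsto
      (fun ε : ℝ => ε ^ (H - 1/2) * w (t - ε) -
        ∫ s in (0 : ℝ)..(t - ε), (1/2 - H) * (t - s) ^ (H - 3/2) * w s)
      (nhdsWithin 0 (Set.Ioi 0)) (nhds z)) :
    z = w t * t ^ (H - 1/2) +
      (1/2 - H) * ∫ r in (0:ℝ)..t, (w t - w (t - r)) * r ^ (H - 3/2) := by
  obtain ⟨hH0, hH1⟩ := hH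
  set v : ℝ → ℝ := fun r => w t - w (t - r) with hv
  have hvc : Continuous v := by fun_prop
  have key : ∀ᶠ ε in nhdsWithin (0:ℝ) (Set.Ioi 0),
      w t * t ^ (H - 1/2) + (1/2 - H) * (∫ r in ε..t, v r * r ^ (H - 3/2)) - (ε ^ (H - 1/2) * w (t - ε) -
        ∫ s in (0 : ℝ)..(t - ε), (1/2 - H) * (t - s) ^ (H - 3/2) * w s) = ε ^ (H - 1/2) * v ε := by
    filter_upwards [Ioo_mem_nhdsGT ht] with ε hε
    have hε0 : 0 < ε := hε.1
    have e1 : ∫ s in (0 : ℝ)..(t - ε), (1/2 - H) * (t - s) ^ (H - 3/2) * w s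
        = ∫ r in ε..t, (1/2 - H) * r ^ (H - 3/2) * w (t - r) := by
      have := intervalIntegral.integral_comp_sub_left (a := ε) (b := t)
        (fun s => (1/2 - H) * (t - s) ^ (H - 3/2) * w s) t
      simp only [sub_self, sub_sub_cancel] at this
      exact this.symm
    have hnot : (0:ℝ) ∉ Set.uIcc ε t := by
      rw [Set.uIcc_of_le hε.2.le]; intro h; linarith [h.1]
    have hc : ContinuousOn (fun r : ℝ => r ^ (H - 3/2)) (Set.uIcc ε t) := by
      intro r hr
      exact (Real.continuousAt_rpow_const r _ (Or.inl (fun h => hnot (h ▸ hr)))).continuousWithinAt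
    have e2 : ∫ r in ε..t, (1/2 - H) * r ^ (H - 3/2) * w (t - r) =
        (1/2 - H) * w t * (∫ r in ε..t, r ^ (H - 3/2)) - (1/2 - H) * (∫ r in ε..t, v r * r ^ (H - 3/2)) := by
      rw [← intervalIntegral.integral_const_mul, ← intervalIntegral.integral_const_mul,
        ← intervalIntegral.integral_sub]
      · congr 1; ext r; simp only [hv]; ring
      · exact (ContinuousOn.mul continuousOn_const hc).intervalIntegrable
      · exact (ContinuousOn.mul continuousOn_const (hvc.continuousOn.mul hc)).intervalIntegrable
    have e3 : ∫ r in ε..t, r ^ (H - 3/2) = (t ^ (H - 1/2) - ε ^ (H - 1/2)) / (H - 1/2) := by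
      rw [integral_rpow (Or.inr ⟨by linarith, hnot⟩)]
      rw [show H - 3/2 + 1 = H - 1/2 by ring]
    have h0 : H - 1/2 ≠ 0 := by linarith
    have e4 : (1/2 - H) * w t * ((t ^ (H - 1/2) - ε ^ (H - 1/2)) / (H - 1/2)) =
        - w t * (t ^ (H - 1/2) - ε ^ (H - 1/2)) := by
      rw [mul_div_assoc', div_eq_iff h0]; ring
    rw [e1, e2, e3, e4]
    simp only [hv]; ring
  have hI : Filter.Tendsto (fun ε => ∫ r in ε..t, v r * r ^ (H - 3/2)) (nhdsWithin 0 (Set.Ioi 0))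
      (nhds (∫ r in (0:ℝ)..t, v r * r ^ (H - 3/2))) := by
    have h1 := intervalIntegral.continuousOn_primitive_interval_left (a := 0) (b := t) (μ := volume)
      (f := fun r => v r * r ^ (H - 3/2)) (by
        rw [Set.uIcc_of_le ht.le, integrableOn_Icc_iff_integrableOn_Ioc]; exact hint)
    have h2 := h1 0 Set.left_mem_uIcc
    rw [Set.uIcc_of_le ht.le] at h2
    refine h2.tendsto.mono_left ?_
    rw [← nhdsWithin_Ioo_eq_nhdsGT ht]
    exact nhdsWithin_mono _ Set.Ioo_subset_Icc_self
  have hl := ((tendsto_const_nhds (x := w t * t ^ (H - 1/2))).add (hI.const_mul (1/2 - H))).sub hZ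
  have hl2 := hl.congr' key
  have := aux_boundary (p := H - 1/2) ht (v := v) (by
    rw [show H - 1/2 - 1 = H - 3/2 by ring]; exact hint) hl2
  linarith

lemma aux_Y {H α t : ℝ} (hH : H ∈ Set.Ioo (0 : ℝ) (1/2)) (hα : α = H + 1/2) (ht : 0 < t)
    {w : ℝ → ℝ} (hw : Continuous w)
    (hint : IntegrableOn (fun r => (w t - w (t - r)) * r ^ (H - 3/2)) (Set.Ioc 0 t)) :
    IntegrableOn (fun x : ℝ => ((1 / Real.Gamma (1/2 - H)) *
      (w t - ∫ s in (0 : ℝ)..t, w s * (x * Real.exp (-(t - s) * x)))) * x ^ (-α)) (Set.Ioi (0 : ℝ)) ∧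
    ∫ x in Set.Ioi (0 : ℝ), ((1 / Real.Gamma (1/2 - H)) *
      (w t - ∫ s in (0 : ℝ)..t, w s * (x * Real.exp (-(t - s) * x)))) * x ^ (-α) =
      w t * t ^ (H - 1/2) +
      (1/2 - H) * ∫ r in (0:ℝ)..t, (w t - w (t - r)) * r ^ (H - 3/2) := by
  obtain ⟨hH0, hH1⟩ := hH
  set v : ℝ → ℝ := fun r => w t - w (t - r) with hv
  have hvc : Continuous v := by fun_prop
  set F : ℝ → ℝ → ℝ := fun x r => v r * (x ^ ((3/2 - H) - 1) * Real.exp (-(r * x))) with hF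
  have hG : Real.Gamma (3/2 - H) = (1/2 - H) * Real.Gamma (1/2 - H) := by
    rw [← Real.Gamma_add_one (by linarith)]; congr 1; ring
  have hGp : 0 < Real.Gamma (1/2 - H) := Real.Gamma_pos_of_pos (by linarith)
  have hGp' : 0 < Real.Gamma (3/2 - H) := Real.Gamma_pos_of_pos (by linarith)
  have hpow : ∀ r : ℝ, 0 < r → (1 / r) ^ (3/2 - H) = r ^ (H - 3/2) := by
    intro r hr
    rw [one_div, Real.inv_rpow hr.le, ← Real.rpow_neg hr.le]; congr 1; ring
  -- Pointwise formula
  have hpt : ∀ x ∈ Set.Ioi (0:ℝ), ((1 / Real.Gamma (1/2 - H)) *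
      (w t - ∫ s in (0 : ℝ)..t, w s * (x * Real.exp (-(t - s) * x)))) * x ^ (-α) =
      (1 / Real.Gamma (1/2 - H)) * (w t * (x ^ ((1/2 - H) - 1) * Real.exp (-(t * x))) +
        ∫ r in Set.Ioc 0 t, F x r) := by
    intro x hx
    have hx0 : 0 < x := hx
    have e1 : ∫ s in (0 : ℝ)..t, w s * (x * Real.exp (-(t - s) * x)) =
        ∫ r in (0:ℝ)..t, w (t - r) * (x * Real.exp (-(r * x))) := by
      have := intervalIntegral.integral_comp_sub_left (a := 0) (b := t)
        (fun s => w s * (x * Real.exp (-(t - s) * x))) t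
      simp only [sub_self, sub_sub_cancel, sub_zero] at this
      rw [← this]; simp only [neg_mul]
    have e2 : ∫ r in (0:ℝ)..t, w (t - r) * (x * Real.exp (-(r * x))) =
        w t * (∫ r in (0:ℝ)..t, x * Real.exp (-(r * x))) -
          ∫ r in (0:ℝ)..t, v r * (x * Real.exp (-(r * x))) := by
      rw [← intervalIntegral.integral_const_mul, ← intervalIntegral.integral_sub]
      · congr 1; ext r; simp only [hv]; ring
      · exact Continuous.intervalIntegrable (by fun_prop) _ _
      · exact Continuous.intervalIntegrable (by fun_prop) _ _
    have e3 : ∫ r in (0:ℝ)..t, x * Real.exp (-(r * x)) = 1 - Real.exp (-(t * x)) := by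
      rw [intervalIntegral.integral_eq_sub_of_hasDerivAt (f := fun r => - Real.exp (-(r * x)))]
      · simp; ring
      · intro r _
        have h0 : HasDerivAt (fun r : ℝ => -(r * x)) (-(1 * x)) r :=
          ((hasDerivAt_id r).mul_const x).neg
        have h : HasDerivAt (fun r : ℝ => -Real.exp (-(r * x)))
            (-(Real.exp (-(r * x)) * (-(1 * x)))) r := h0.exp.neg
        exact h.congr_deriv (by ring)
      · exact Continuous.intervalIntegrable (by fun_prop) _ _
    have e4 : (∫ r in (0:ℝ)..t, v r * (x * Real.exp (-(r * x)))) * x ^ (-α) =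
        ∫ r in Set.Ioc 0 t, F x r := by
      rw [← intervalIntegral.integral_mul_const, intervalIntegral.integral_of_le ht.le]
      congr 1; ext r
      simp only [hF]
      rw [show 3/2 - H - 1 = -α + 1 by rw [hα]; ring, Real.rpow_add_one hx0.ne']
      ring
    rw [e1, e2, e3, ← e4, show 1/2 - H - 1 = -α by rw [hα]; ring]
    ring
  have hFint : Integrable (Function.uncurry F)
      ((volume.restrict (Set.Ioi (0:ℝ))).prod (volume.restrict (Set.Ioc 0 t))) := by
    rw [integrable_prod_iff']
    · constructor
      · filter_upwards [ae_restrict_mem measurableSet_Ioc] with r hr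
        exact (aux_gamma (a := 3/2 - H) (by linarith) hr.1).const_mul (v r)
      · refine (hint.norm.mul_const (Real.Gamma (3/2 - H))).congr ?_
        filter_upwards [ae_restrict_mem measurableSet_Ioc] with r hr
        have hr0 : 0 < r := hr.1
        have : ∀ x ∈ Set.Ioi (0:ℝ), ‖Function.uncurry F (x, r)‖ =
            ‖v r‖ * (x ^ ((3/2 - H) - 1) * Real.exp (-(r * x))) := by
          intro x hx
          have hx0 : 0 < x := hx
          simp only [Function.uncurry, hF]
          have hn : 0 ≤ x ^ ((3/2 - H) - 1) * Real.exp (-(r * x)) := by positivity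
          rw [norm_mul, Real.norm_of_nonneg hn]
        rw [setIntegral_congr_fun measurableSet_Ioi this, integral_const_mul,
          Real.integral_rpow_mul_exp_neg_mul_Ioi (by linarith) hr0, hpow r hr0, norm_mul,
          Real.norm_of_nonneg (Real.rpow_nonneg hr0.le _)]
        ring
    · apply Measurable.aestronglyMeasurable
      simp only [hF, Function.uncurry_def]
      fun_prop
  have hA := (aux_gamma (a := 1/2 - H) (by linarith) ht).const_mul (w t)
  have hB := hFint.integral_prod_left
  simp only [Function.uncurry] at hB
  constructor
  · rw [integrableOn_congr_fun hpt measurableSet_Ioi]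
    exact (hA.add hB).const_mul _
  · rw [setIntegral_congr_fun measurableSet_Ioi hpt, integral_const_mul, integral_add hA hB,
      integral_const_mul, Real.integral_rpow_mul_exp_neg_mul_Ioi (by linarith) ht,
      integral_integral_swap hFint, intervalIntegral.integral_of_le ht.le]
    have : ∀ r ∈ Set.Ioc 0 t, ∫ x in Set.Ioi (0:ℝ), F x r =
        (v r * r ^ (H - 3/2)) * Real.Gamma (3/2 - H) := by
      intro r hr
      simp only [hF]
      rw [integral_const_mul, Real.integral_rpow_mul_exp_neg_mul_Ioi (by linarith) hr.1,
        hpow r hr.1]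
      ring
    rw [setIntegral_congr_fun measurableSet_Ioc this, integral_mul_const, hG,
      one_div t, Real.inv_rpow ht.le, ← Real.rpow_neg ht.le, show -(1/2 - H) = H - 1/2 by ring]
    change _ = w t * t ^ (H - 1/2) + (1/2 - H) * ∫ r in Set.Ioc 0 t, v r * r ^ (H - 3/2)
    generalize Real.Gamma (1/2 - H) = g at hGp
    generalize (∫ r in Set.Ioc 0 t, v r * r ^ (H - 3/2)) = I
    have hg : g ≠ 0 := hGp.ne'
    rw [one_div, inv_mul_eq_iff_eq_mul₀ hg]
    ring

lemma aux_prob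
    {Ω : Type*} [MeasurableSpace Ω] (P : Measure Ω) [IsProbabilityMeasure P]
    (H t : ℝ) (hH : H ∈ Set.Ioo (0 : ℝ) (1/2)) (ht : 0 < t)
    (W : ℝ → Ω → ℝ)
    (hW_cont : ∀ ω, Continuous fun s => W s ω)
    (hW_meas : ∀ s, Measurable (W s))
    (hW_gauss : ∀ u v : ℝ, 0 ≤ u → u ≤ v →
      Measure.map (fun ω => W v ω - W u ω) P = gaussianReal 0 (Real.toNNReal (v - u))) :
    ∀ᵐ ω ∂P, IntegrableOn (fun r => (W t ω - W (t - r) ω) * r ^ (H - 3/2)) (Set.Ioc 0 t) := by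
  have hm0 : Measurable (Function.uncurry W) :=
    measurable_uncurry_of_continuous_of_measurable hW_cont hW_meas
  set f : Ω → ℝ → ENNReal := fun ω r =>
    ENNReal.ofReal ((W t ω - W (t - r) ω) ^ 2) * ENNReal.ofReal (r ^ (H - 2)) with hf
  have hm1 : Measurable (fun q : Ω × ℝ => W (t - q.2) q.1) :=
    hm0.comp (f := fun q : Ω × ℝ => (t - q.2, q.1)) (by fun_prop)
  have hfm : Measurable (Function.uncurry f) := by
    have : Measurable (fun q : Ω × ℝ => W t q.1) := (hW_meas t).comp measurable_fst
    simp only [hf, Function.uncurry_def]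
    fun_prop
  have hvar : ∀ r ∈ Set.Ioc 0 t, ∫⁻ ω, f ω r ∂P = ENNReal.ofReal (r ^ (H - 1)) := by
    intro r hr
    have hr0 : 0 < r := hr.1
    have hD : Measurable (fun ω => W t ω - W (t - r) ω) := (hW_meas t).sub (hW_meas _)
    have hg := hW_gauss (t - r) t (by linarith [hr.2]) (by linarith)
    rw [sub_sub_cancel] at hg
    have h1 : ∫⁻ ω, ENNReal.ofReal ((W t ω - W (t - r) ω) ^ 2) ∂P = ENNReal.ofReal r := by
      have h2 : ∫⁻ y, ENNReal.ofReal (y ^ 2) ∂(gaussianReal 0 (Real.toNNReal r)) = ENNReal.ofReal r := by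
        have h3 := evariance_eq_lintegral_ofReal (id : ℝ → ℝ) (gaussianReal 0 (Real.toNNReal r))
        simp only [id, integral_id_gaussianReal, sub_zero] at h3
        rw [← h3]
        have h4 := variance_id_gaussianReal (μ := 0) (v := Real.toNNReal r)
        have h5 := (memLp_id_gaussianReal (μ := 0) (v := Real.toNNReal r) 2).ofReal_variance_eq
        rw [h4] at h5
        rw [Real.coe_toNNReal _ hr0.le] at h5
        exact h5.symm
      rw [← h2, ← hg, lintegral_map (by fun_prop) hD]
    simp only [hf]
    rw [lintegral_mul_const _ (by fun_prop), h1, ← ENNReal.ofReal_mul hr0.le]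
    congr 1
    rw [show H - 1 = (H - 2) + 1 by ring, Real.rpow_add_one hr0.ne']; ring
  have hr1 : IntegrableOn (fun r : ℝ => r ^ (H - 1)) (Set.Ioc 0 t) :=
    (intervalIntegrable_iff_integrableOn_Ioc_of_le ht.le).1
      (intervalIntegral.intervalIntegrable_rpow' (by linarith [hH.1]))
  have hfin : ∫⁻ ω, (∫⁻ r in Set.Ioc 0 t, f ω r) ∂P ≠ ⊤ := by
    rw [lintegral_lintegral_swap hfm.aemeasurable, setLIntegral_congr_fun measurableSet_Ioc hvar]
    exact hr1.lintegral_lt_top.ne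
  have hae := ae_lt_top (hfm.lintegral_prod_right' (ν := volume.restrict (Set.Ioc 0 t))) hfin
  filter_upwards [hae] with ω hω
  have hc := hW_cont ω
  have hmv : Measurable (fun r => W t ω - W (t - r) ω) :=
    Continuous.measurable (continuous_const.sub (hc.comp (continuous_const.sub continuous_id)))
  have hq : IntegrableOn (fun r => (W t ω - W (t - r) ω) ^ 2 * r ^ (H - 2)) (Set.Ioc 0 t) := by
    refine ⟨Measurable.aestronglyMeasurable (by fun_prop), ?_⟩
    rw [hasFiniteIntegral_iff_norm]
    refine lt_of_eq_of_lt ?_ hω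
    refine setLIntegral_congr_fun measurableSet_Ioc ?_
    intro r hr
    have hr0 : 0 < r := hr.1
    simp only [hf, Function.uncurry]
    rw [Real.norm_of_nonneg (by positivity), ENNReal.ofReal_mul (by positivity)]
  refine Integrable.mono' (hq.add hr1) (Measurable.aestronglyMeasurable (by fun_prop)) ?_
  filter_upwards [ae_restrict_mem measurableSet_Ioc] with r hr
  have hr0 : 0 < r := hr.1
  simp only [Pi.add_apply]
  set d := W t ω - W (t - r) ω
  rw [norm_mul, Real.norm_of_nonneg (Real.rpow_nonneg hr0.le _), Real.norm_eq_abs]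
  set a := r ^ ((H - 2) / 2) with ha
  set b := r ^ ((H - 1) / 2) with hb
  have ha0 : 0 < a := by positivity
  have hb0 : 0 < b := by positivity
  have h1 : r ^ (H - 3/2) = a * b := by rw [ha, hb, ← Real.rpow_add hr0]; congr 1; ring
  have h2 : r ^ (H - 2) = a * a := by rw [ha, ← Real.rpow_add hr0]; congr 1; ring
  have h3 : r ^ (H - 1) = b * b := by rw [hb, ← Real.rpow_add hr0]; congr 1; ring
  rw [h1, h2, h3, ← sq_abs d]
  have : 0 ≤ |d| * a * b := by positivity
  nlinarith [sq_nonneg (|d| * a - b)]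

/-- Markovian representation of Volterra Brownian motion: for fixed `t`, almost surely the
integral over the Ornstein--Uhlenbeck field `Y_t(x) = (1/Γ(1/2-H)) ∫₀^t e^{-(t-s)x} dW_s`
(realized pathwise via integration by parts) against `x^{-α} dx` is absolutely convergent
and equals the Wiener integral `∫₀^t (t-s)^{H-1/2} dW_s` (realized as the a.s. limit of its
pathwise integration-by-parts truncations `Z`). -/
theorem volterra_integral_representation
    {Ω : Type*} [MeasurableSpace Ω] (P : Measure Ω) [IsProbabilityMeasure P]
    (H α t : ℝ) (hH : H ∈ Set.Ioo (0 : ℝ) (1/2)) (hα : α = H + 1/2) (ht : 0 < t)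
    (W : ℝ → Ω → ℝ)
    (hW_cont : ∀ ω, Continuous fun s => W s ω)
    (hW_zero : ∀ ω, W 0 ω = 0)
    (hW_meas : ∀ s, Measurable (W s))
    (hW_gauss : ∀ u v : ℝ, 0 ≤ u → u ≤ v →
      Measure.map (fun ω => W v ω - W u ω) P = gaussianReal 0 (Real.toNNReal (v - u)))
    (Y : ℝ → Ω → ℝ)
    (hY : ∀ x ω, Y x ω = (1 / Real.Gamma (1/2 - H)) *
      (W t ω - ∫ s in (0 : ℝ)..t, W s ω * (x * Real.exp (-(t - s) * x))))
    (Z : Ω → ℝ)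
    (hZ : ∀ᵐ ω ∂P, Filter.Tendsto
      (fun ε : ℝ => ε ^ (H - 1/2) * W (t - ε) ω -
        ∫ s in (0 : ℝ)..(t - ε), (1/2 - H) * (t - s) ^ (H - 3/2) * W s ω)
      (nhdsWithin 0 (Set.Ioi 0)) (nhds (Z ω))) :
    ∀ᵐ ω ∂P,
      MeasureTheory.IntegrableOn (fun x : ℝ => Y x ω * x ^ (-α)) (Set.Ioi (0 : ℝ)) ∧
      ∫ x in Set.Ioi (0 : ℝ), Y x ω * x ^ (-α) = Z ω := by
  filter_upwards [hZ, aux_prob P H t hH ht W hW_cont hW_meas hW_gauss] with ω hz hi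
  simp only [hY]
  have h1 := aux_Y hH hα ht (hW_cont ω) hi
  have h2 := aux_Z hH ht (hW_cont ω) hi hz
  exact ⟨h1.1, h1.2.trans h2.symm⟩
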